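/- Suppose the matrix A together with γ̄ satisfies Assumption 2 and X(t) is generated by the algorithm X(t+1) = P_{γ̄}(A X(t)) from X₀ ∈ S(n,d,γ̄). Let C(A) = { Σᵢ λᵢ [A]ᵢ : λᵢ ≥ 0 } be the conic hull of the rows of A, and let C^⊥(A) = { x ∈ ℝⁿ : ∃ y ∈ C(A), y ≠ 0, y xᵀ = 0 }. If some column c of X₀ is nonzero and cᵀ ∉ C^⊥(A), then v(X₀)X₀ ≠ 0 (where v(X₀) is the strictly positive unit vector to which all Euclidean-normalized rows of Ã(k,t₀,X₀) converge, and v(X₀) ∈ C(A)), and consequently asymptotic consensus of directions with point-wise convergence holds. -/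

import Mathlib

open Finset Filter Topology Matrix

noncomputable def euclNorm {d : ℕ} (x : Fin d → ℝ) : ℝ := Real.sqrt (∑ j, x j ^ 2)

def unitSphere (d : ℕ) : Set (Fin d → ℝ) := {x | euclNorm x = 1}

/-- A directional function on `S^{d-1}`: continuous and bounded above and below
by positive constants on the unit sphere. -/
def IsDirectional {d : ℕ} (γ : (Fin d → ℝ) → ℝ) : Prop :=
  ContinuousOn γ (unitSphere d) ∧
    ∃ c C : ℝ, 0 < c ∧ ∀ x ∈ unitSphere d, c ≤ γ x ∧ γ x ≤ C

/-- The star boundary `S^{d-1}_γ = {γ(x) x : x ∈ S^{d-1}}`. -/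
def starBoundary {d : ℕ} (γ : (Fin d → ℝ) → ℝ) : Set (Fin d → ℝ) :=
  {y | ∃ x ∈ unitSphere d, y = γ x • x}

/-- `S(n,d,γ̄)`: matrices whose `i`-th row lies on the star boundary of `γ_i`. -/
def Sset (n d : ℕ) (γbar : Fin n → (Fin d → ℝ) → ℝ) : Set (Matrix (Fin n) (Fin d) ℝ) :=
  {X | ∀ i, X i ∈ starBoundary (γbar i)}

/-- Radial projection `P_γ(y) = γ(y/‖y‖₂) · y/‖y‖₂`. -/
noncomputable def radialProj {d : ℕ} (γ : (Fin d → ℝ) → ℝ) (y : Fin d → ℝ) : Fin d → ℝ :=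
  γ ((euclNorm y)⁻¹ • y) • ((euclNorm y)⁻¹ • y)

/-- Row-wise radial projection. -/
noncomputable def rowProj {n d : ℕ} (γbar : Fin n → (Fin d → ℝ) → ℝ)
    (B : Matrix (Fin n) (Fin d) ℝ) : Matrix (Fin n) (Fin d) ℝ :=
  Matrix.of fun i => radialProj (γbar i) (B i)

/-- Assumption 2: each `γ_i` is directional, `A` is a nonnegative weight matrix of a strongly
connected digraph, and the diagonal-dominance condition
`a_ii · min γ_i > Σ_{j≠i} a_ij · max γ_j` holds. -/
def Assumption2 {n d : ℕ} (A : Matrix (Fin n) (Fin n) ℝ)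
    (γbar : Fin n → (Fin d → ℝ) → ℝ) : Prop :=
  (∀ i, IsDirectional (γbar i)) ∧
  (∃ E : Fin n → Fin n → Prop,
    (∀ i j, E i j → 0 < A i j) ∧ (∀ i j, ¬ E i j → A i j = 0) ∧
    (∀ i j, Relation.ReflTransGen E i j)) ∧
  (∀ i, (∑ j ∈ Finset.univ.erase i, A i j * sSup (γbar j '' unitSphere d)) <
      A i i * sInf (γbar i '' unitSphere d))

/-- The trajectory of the algorithm `X(t+1) = P_γ̄(A X(t))`, indexed by `k = t - t₀`. -/
noncomputable def traj {n d : ℕ} (A : Matrix (Fin n) (Fin n) ℝ)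
    (γbar : Fin n → (Fin d → ℝ) → ℝ) (X₀ : Matrix (Fin n) (Fin d) ℝ) :
    ℕ → Matrix (Fin n) (Fin d) ℝ
  | 0 => X₀
  | k + 1 => rowProj γbar (A * traj A γbar X₀ k)

/-- `D_γ̄(B)`: diagonal matrix with entries `γ_i([B]_i/‖[B]_i‖₂)/‖[B]_i‖₂`. -/
noncomputable def Dmat {n d : ℕ} (γbar : Fin n → (Fin d → ℝ) → ℝ)
    (B : Matrix (Fin n) (Fin d) ℝ) : Matrix (Fin n) (Fin n) ℝ :=
  Matrix.diagonal fun i => γbar i ((euclNorm (B i))⁻¹ • B i) / euclNorm (B i)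

/-- The product matrices `Ã(k,t₀,X₀) = D_γ̄(A X(t₀+k−1))A ⋯ D_γ̄(A X(t₀))A`. -/
noncomputable def Atilde {n d : ℕ} (A : Matrix (Fin n) (Fin n) ℝ)
    (γbar : Fin n → (Fin d → ℝ) → ℝ) (X₀ : Matrix (Fin n) (Fin d) ℝ) :
    ℕ → Matrix (Fin n) (Fin n) ℝ
  | 0 => 1
  | k + 1 => Dmat γbar (A * traj A γbar X₀ k) * A * Atilde A γbar X₀ k

/-- `v` is the strictly positive unit vector to which all Euclidean-normalized rows of
`Ã(k,t₀,X₀)` converge. -/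
def IsLimitVec {n d : ℕ} (A : Matrix (Fin n) (Fin n) ℝ)
    (γbar : Fin n → (Fin d → ℝ) → ℝ) (X₀ : Matrix (Fin n) (Fin d) ℝ)
    (v : Fin n → ℝ) : Prop :=
  euclNorm v = 1 ∧ (∀ i, 0 < v i) ∧
    ∀ i, Tendsto (fun k => (euclNorm (Atilde A γbar X₀ k i))⁻¹ • Atilde A γbar X₀ k i)
      atTop (𝓝 v)

/-- Asymptotic consensus of directions. -/
def ConsensusDir {n d : ℕ} (X : ℕ → Matrix (Fin n) (Fin d) ℝ) : Prop :=
  ∀ i j, Tendsto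
    (fun t => euclNorm ((euclNorm (X t i))⁻¹ • X t i - (euclNorm (X t j))⁻¹ • X t j))
    atTop (𝓝 0)

/-- Asymptotic consensus of directions with point-wise convergence to a unit vector. -/
def ConsensusPW {n d : ℕ} (X : ℕ → Matrix (Fin n) (Fin d) ℝ) : Prop :=
  ∃ u : Fin d → ℝ, euclNorm u = 1 ∧
    ∀ i, Tendsto (fun t => (euclNorm (X t i))⁻¹ • X t i) atTop (𝓝 u)

/-- The minimum cone `C(A)`: all conic combinations of the rows of `A`. -/
def minCone {n : ℕ} (A : Matrix (Fin n) (Fin n) ℝ) : Set (Fin n → ℝ) :=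
  {y | ∃ lam : Fin n → ℝ, (∀ i, 0 ≤ lam i) ∧ y = Matrix.vecMul lam A}

/-- `C^⊥(A) = {x : ∃ y ∈ C(A), y ≠ 0, y xᵀ = 0}`. -/
def minConePerp {n : ℕ} (A : Matrix (Fin n) (Fin n) ℝ) : Set (Fin n → ℝ) :=
  {x | ∃ y ∈ minCone A, y ≠ (0 : Fin n → ℝ) ∧ ∑ i, y i * x i = 0}

theorem euclNorm_nonneg {d : ℕ} (x : Fin d → ℝ) : 0 ≤ euclNorm x := Real.sqrt_nonneg _

theorem euclNorm_smul {d : ℕ} (s : ℝ) (x : Fin d → ℝ) :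
    euclNorm (s • x) = |s| * euclNorm x := by
  simp only [euclNorm, Pi.smul_apply, smul_eq_mul, mul_pow, ← Finset.mul_sum]
  rw [Real.sqrt_mul (sq_nonneg s), Real.sqrt_sq_eq_abs]

theorem euclNorm_eq_zero {d : ℕ} {x : Fin d → ℝ} : euclNorm x = 0 ↔ x = 0 := by
  rw [euclNorm, Real.sqrt_eq_zero (Finset.sum_nonneg fun _ _ => sq_nonneg _),
    Finset.sum_eq_zero_iff_of_nonneg fun _ _ => sq_nonneg _]
  simp [funext_iff]

theorem continuous_euclNorm {d : ℕ} : Continuous (euclNorm : (Fin d → ℝ) → ℝ) := by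
  unfold euclNorm
  fun_prop

theorem euclNorm_normalize {d : ℕ} {x : Fin d → ℝ} (hx : x ≠ 0) :
    euclNorm ((euclNorm x)⁻¹ • x) = 1 := by
  have h : euclNorm x ≠ 0 := mt euclNorm_eq_zero.1 hx
  rw [euclNorm_smul, abs_of_nonneg (inv_nonneg.2 (euclNorm_nonneg x)), inv_mul_cancel₀ h]

theorem normalize_smul {d : ℕ} {s : ℝ} (hs : 0 < s) (x : Fin d → ℝ) :
    (euclNorm (s • x))⁻¹ • s • x = (euclNorm x)⁻¹ • x := by
  rw [euclNorm_smul, abs_of_pos hs, smul_smul, mul_inv, mul_right_comm,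
    inv_mul_cancel₀ hs.ne', one_mul]

theorem unitSphere_nonempty {d : ℕ} (hd : 1 ≤ d) : (unitSphere d).Nonempty := by
  have hx : (fun _ => 1 : Fin d → ℝ) ≠ 0 := fun h => one_ne_zero (congrFun h ⟨0, hd⟩)
  exact ⟨_, euclNorm_normalize hx⟩

theorem IsDirectional.sInf_pos {d : ℕ} (hd : 1 ≤ d) {γ : (Fin d → ℝ) → ℝ}
    (hγ : IsDirectional γ) : 0 < sInf (γ '' unitSphere d) := by
  obtain ⟨-, c, C, hc, h⟩ := hγ
  refine hc.trans_le (le_csInf ((unitSphere_nonempty hd).image γ) ?_)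
  rintro _ ⟨x, hx, rfl⟩
  exact (h x hx).1

theorem IsDirectional.sInf_le_sSup {d : ℕ} (hd : 1 ≤ d) {γ : (Fin d → ℝ) → ℝ}
    (hγ : IsDirectional γ) : sInf (γ '' unitSphere d) ≤ sSup (γ '' unitSphere d) := by
  obtain ⟨-, c, C, hc, h⟩ := hγ
  refine csInf_le_csSup ((unitSphere_nonempty hd).image γ) ⟨c, ?_⟩ ⟨C, ?_⟩
  · rintro _ ⟨x, hx, rfl⟩
    exact (h x hx).1
  · rintro _ ⟨x, hx, rfl⟩
    exact (h x hx).2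

theorem IsDirectional.div_nonneg {d : ℕ} {γ : (Fin d → ℝ) → ℝ} (hγ : IsDirectional γ)
    (y : Fin d → ℝ) : 0 ≤ γ ((euclNorm y)⁻¹ • y) / euclNorm y := by
  obtain ⟨-, c, C, hc, h⟩ := hγ
  rcases eq_or_ne y 0 with rfl | hy
  · simp [euclNorm_eq_zero.2 rfl]
  · exact _root_.div_nonneg (hc.le.trans (h _ (euclNorm_normalize hy)).1) (euclNorm_nonneg y)

section Assumption

variable {n d : ℕ} {A : Matrix (Fin n) (Fin n) ℝ} {γbar : Fin n → (Fin d → ℝ) → ℝ}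

theorem Assumption2.nonneg (hA : Assumption2 A γbar) (i j : Fin n) : 0 ≤ A i j := by
  obtain ⟨-, ⟨E, hpos, hzero, -⟩, -⟩ := hA
  by_cases h : E i j
  · exact (hpos i j h).le
  · exact (hzero i j h).ge

theorem Assumption2.det_ne_zero (hd : 1 ≤ d) (hA : Assumption2 A γbar) : A.det ≠ 0 := by
  have hnn := hA.nonneg
  obtain ⟨hdir, -, hdom⟩ := hA
  set m : Fin n → ℝ := fun j => sInf (γbar j '' unitSphere d)
  have hm : ∀ j, 0 < m j := fun j => (hdir j).sInf_pos hd
  have key : (A * Matrix.diagonal m).det ≠ 0 := by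
    refine det_ne_zero_of_sum_row_lt_diag fun i => ?_
    have habs : ∀ j, ‖(A * Matrix.diagonal m) i j‖ = A i j * m j := fun j => by
      rw [Matrix.mul_diagonal, Real.norm_of_nonneg (mul_nonneg (hnn i j) (hm j).le)]
    simp only [habs]
    exact (Finset.sum_le_sum fun j _ => mul_le_mul_of_nonneg_left
      ((hdir j).sInf_le_sSup hd) (hnn i j)).trans_lt (hdom i)
  rw [Matrix.det_mul] at key
  exact left_ne_zero_of_mul key

theorem Dmat_nonneg (hγ : ∀ i, IsDirectional (γbar i)) (B : Matrix (Fin n) (Fin d) ℝ)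
    (i j : Fin n) : 0 ≤ Dmat γbar B i j := by
  rw [Dmat, Matrix.diagonal_apply]
  split_ifs
  · exact (hγ i).div_nonneg (B i)
  · exact le_rfl

theorem Matrix.mul_nonneg_entries {P Q : Matrix (Fin n) (Fin n) ℝ} (hP : ∀ i j, 0 ≤ P i j)
    (hQ : ∀ i j, 0 ≤ Q i j) (i j : Fin n) : 0 ≤ (P * Q) i j := by
  rw [Matrix.mul_apply]
  exact Finset.sum_nonneg fun k _ => mul_nonneg (hP i k) (hQ k j)

theorem rowProj_eq_Dmat_mul (B : Matrix (Fin n) (Fin d) ℝ) :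
    rowProj γbar B = Dmat γbar B * B := by
  ext i j
  simp [rowProj, radialProj, Dmat, Matrix.diagonal_mul, div_eq_mul_inv, mul_assoc]

theorem traj_eq_Atilde_mul (X₀ : Matrix (Fin n) (Fin d) ℝ) (k : ℕ) :
    traj A γbar X₀ k = Atilde A γbar X₀ k * X₀ := by
  induction k with
  | zero => simp [traj, Atilde]
  | succ k ih =>
    have h : traj A γbar X₀ (k + 1) =
        Dmat γbar (A * traj A γbar X₀ k) * (A * traj A γbar X₀ k) := rowProj_eq_Dmat_mul _
    rw [h, Atilde, Matrix.mul_assoc, Matrix.mul_assoc, ← ih]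

theorem Assumption2.exists_Atilde_succ_eq_mul (hA : Assumption2 A γbar)
    (X₀ : Matrix (Fin n) (Fin d) ℝ) (k : ℕ) :
    ∃ P : Matrix (Fin n) (Fin n) ℝ, (∀ i j, 0 ≤ P i j) ∧ Atilde A γbar X₀ (k + 1) = P * A := by
  induction k with
  | zero => exact ⟨_, Dmat_nonneg hA.1 _, by rw [Atilde, Atilde, Matrix.mul_one]⟩
  | succ k ih =>
    obtain ⟨P, hP, h⟩ := ih
    refine ⟨_, Matrix.mul_nonneg_entries (Matrix.mul_nonneg_entries
      (Dmat_nonneg hA.1 (A * traj A γbar X₀ (k + 1))) hA.nonneg) hP, ?_⟩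
    rw [Atilde, h, ← Matrix.mul_assoc]

theorem isClosed_minCone (hdet : A.det ≠ 0) : IsClosed (minCone A) := by
  have hu : IsUnit A.det := hdet.isUnit
  have h : minCone A = {y | ∀ i, 0 ≤ Matrix.vecMul y A⁻¹ i} := by
    ext y
    constructor
    · rintro ⟨lam, hlam, rfl⟩
      simpa [Matrix.vecMul_vecMul, Matrix.mul_nonsing_inv A hu] using hlam
    · intro hy
      exact ⟨_, hy, by simp [Matrix.vecMul_vecMul, Matrix.nonsing_inv_mul A hu]⟩
  rw [h, Set.ofPred_forall]
  refine isClosed_iInter fun i => isClosed_le continuous_const ?_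
  simp only [Matrix.vecMul, dotProduct]
  fun_prop

theorem Assumption2.limitVec_mem_minCone (hn : 1 ≤ n) (hd : 1 ≤ d) (hA : Assumption2 A γbar)
    {X₀ : Matrix (Fin n) (Fin d) ℝ} {v : Fin n → ℝ} (hv : IsLimitVec A γbar X₀ v) :
    v ∈ minCone A := by
  refine (isClosed_minCone (hA.det_ne_zero hd)).mem_of_tendsto
    ((hv.2.2 ⟨0, hn⟩).comp (tendsto_add_atTop_nat 1)) (Eventually.of_forall fun k => ?_)
  obtain ⟨P, hP, h⟩ := hA.exists_Atilde_succ_eq_mul X₀ k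
  simp only [Function.comp_apply]
  rw [h]
  refine ⟨(euclNorm ((P * A) ⟨0, hn⟩))⁻¹ • P ⟨0, hn⟩, fun i =>
    mul_nonneg (inv_nonneg.2 (euclNorm_nonneg _)) (hP _ i), ?_⟩
  rw [Matrix.smul_vecMul]
  rfl

theorem IsLimitVec.tendsto_normalize_traj {X₀ : Matrix (Fin n) (Fin d) ℝ} {v : Fin n → ℝ}
    (hv : IsLimitVec A γbar X₀ v) (hne : Matrix.vecMul v X₀ ≠ 0) (i : Fin n) :
    Tendsto (fun k => (euclNorm (traj A γbar X₀ k i))⁻¹ • traj A γbar X₀ k i) atTop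
      (𝓝 ((euclNorm (Matrix.vecMul v X₀))⁻¹ • Matrix.vecMul v X₀)) := by
  obtain ⟨hv1, -, hlim⟩ := hv
  have hv0 : v ≠ 0 := by
    rintro rfl
    rw [euclNorm_eq_zero.2 rfl] at hv1
    exact zero_ne_one hv1
  have hcont : Continuous fun w : Fin n → ℝ => Matrix.vecMul w X₀ :=
    continuous_id.matrix_vecMul continuous_const
  have hw := (hcont.tendsto v).comp (hlim i)
  have hnorm := ((continuous_euclNorm.tendsto _).comp hw).inv₀ (mt euclNorm_eq_zero.1 hne)
  refine (hnorm.smul hw).congr' ?_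
  filter_upwards [(hlim i).eventually_ne hv0] with k hk
  have hpos : 0 < (euclNorm (Atilde A γbar X₀ k i))⁻¹ :=
    (inv_nonneg.2 (euclNorm_nonneg _)).lt_of_ne fun h => hk (by rw [← h, zero_smul])
  have hrow : traj A γbar X₀ k i = Matrix.vecMul (Atilde A γbar X₀ k i) X₀ := by
    rw [traj_eq_Atilde_mul]
    rfl
  rw [hrow, ← normalize_smul hpos, ← Matrix.smul_vecMul]
  rfl

end Assumption

theorem stmt18 {n d : ℕ} (hn : 1 ≤ n) (hd : 1 ≤ d)
    (A : Matrix (Fin n) (Fin n) ℝ) (γbar : Fin n → (Fin d → ℝ) → ℝ)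
    (hA : Assumption2 A γbar)
    (X₀ : Matrix (Fin n) (Fin d) ℝ) (hX₀ : X₀ ∈ Sset n d γbar)
    (v : Fin n → ℝ) (hv : IsLimitVec A γbar X₀ v)
    (c : Fin d) (hc : (fun i => X₀ i c) ≠ (0 : Fin n → ℝ))
    (hcperp : (fun i => X₀ i c) ∉ minConePerp A) :
    v ∈ minCone A ∧ Matrix.vecMul v X₀ ≠ (0 : Fin d → ℝ) ∧
      ConsensusDir (traj A γbar X₀) ∧ ConsensusPW (traj A γbar X₀) := by
  have hmem := hA.limitVec_mem_minCone hn hd hv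
  have hne : Matrix.vecMul v X₀ ≠ 0 := fun h =>
    hcperp ⟨v, hmem, fun h0 => (hv.2.1 ⟨0, hn⟩).ne' (congrFun h0 _), congrFun h c⟩
  have hlim := hv.tendsto_normalize_traj hne
  refine ⟨hmem, hne, fun i j => ?_, _, euclNorm_normalize hne, hlim⟩
  have h := (continuous_euclNorm.tendsto _).comp ((hlim i).sub (hlim j))
  rwa [sub_self, euclNorm_eq_zero.2 rfl] at h
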